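/- Let X₁ and X₂ be independent real random variables with distribution functions F_{X₁} and F_{X₂}. If both F_{X₁} and F_{X₂} belong to the class 𝒪ℒ, then the distribution function F_{X₁}∗F_{X₂} of the sum X₁ + X₂ belongs to the class 𝒪ℒ. -/

import Mathlib

open MeasureTheory ProbabilityTheory Filter

noncomputable section

/-- The distribution function of a real random variable `X`. -/
def df {Ω : Type*} [MeasurableSpace Ω] (P : Measure Ω) (X : Ω → ℝ) : ℝ → ℝ :=
  fun x => (P {ω | X ω ≤ x}).toReal

/-- `F` belongs to the class `𝒪ℒ` of `𝒪`-exponential distribution functions: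
for every `a ∈ ℝ`, `0 < liminf_{x→∞} F̄(x+a)/F̄(x)` and `limsup_{x→∞} F̄(x+a)/F̄(x) < ∞`,
where `F̄ = 1 - F`. -/
def MemOL (F : ℝ → ℝ) : Prop :=
  ∀ a : ℝ,
    (∃ c : ℝ, 0 < c ∧ ∀ᶠ x in atTop, c ≤ (1 - F (x + a)) / (1 - F x)) ∧
    (∃ C : ℝ, ∀ᶠ x in atTop, (1 - F (x + a)) / (1 - F x) ≤ C)

theorem one_sub_df {Ω : Type*} [MeasurableSpace Ω] (P : Measure Ω) [IsProbabilityMeasure P]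
    {X : Ω → ℝ} (hX : Measurable X) (x : ℝ) : 1 - df P X x = P.real {ω | x < X ω} := by
  have h : {ω | x < X ω} = {ω | X ω ≤ x}ᶜ := by ext; simp
  rw [h, probReal_compl_eq_one_sub (measurableSet_le hX measurable_const)]
  rfl

/-- A distribution function is in `𝒪ℒ` iff its tail is positive and, under each fixed shift,
decreases by at most a constant factor uniformly on the whole line. -/
theorem memOL_df_iff {Ω : Type*} [MeasurableSpace Ω] (P : Measure Ω) [IsProbabilityMeasure P]
    {X : Ω → ℝ} (hX : Measurable X) :
    MemOL (df P X) ↔ (∀ x, 0 < P.real {ω | x < X ω}) ∧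
      ∀ a : ℝ, ∃ C : ℝ, 0 < C ∧
        ∀ x, P.real {ω | x < X ω} ≤ C * P.real {ω | x + a < X ω} := by
  have hanti : Antitone fun x => P.real {ω | x < X ω} := fun x y hxy =>
    measureReal_mono fun ω (hω : y < X ω) => hxy.trans_lt hω
  simp only [MemOL, one_sub_df P hX]
  constructor
  · intro h
    have hpos : ∀ x, 0 < P.real {ω | x < X ω} := by
      intro x
      obtain ⟨c, hc, hev⟩ := (h 0).1
      obtain ⟨y, hy, hxy⟩ := (hev.and (eventually_ge_atTop x)).exists
      refine lt_of_lt_of_le (lt_of_le_of_ne measureReal_nonneg fun h0 => ?_) (hanti hxy)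
      rw [← h0, div_zero] at hy
      exact hc.not_ge hy
    refine ⟨hpos, fun a => ?_⟩
    obtain ⟨c, hc, hev⟩ := (h a).1
    obtain ⟨x₀, hx₀⟩ := eventually_atTop.1 hev
    refine ⟨max c⁻¹ (P.real {ω | x₀ + a < X ω})⁻¹, lt_max_of_lt_left (inv_pos.2 hc),
      fun x => ?_⟩
    rcases le_total x₀ x with hx | hx
    · have h1 := (le_div_iff₀ (hpos x)).1 (hx₀ x hx)
      calc P.real {ω | x < X ω} ≤ c⁻¹ * P.real {ω | x + a < X ω} := by
            rwa [inv_mul_eq_div, le_div_iff₀' hc]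
        _ ≤ _ := by gcongr; exact le_max_left _ _
    · calc P.real {ω | x < X ω} ≤ 1 := measureReal_le_one
        _ = (P.real {ω | x₀ + a < X ω})⁻¹ * P.real {ω | x₀ + a < X ω} :=
            (inv_mul_cancel₀ (hpos _).ne').symm
        _ ≤ _ := mul_le_mul (le_max_right _ _) (hanti (by linarith)) measureReal_nonneg
            (le_max_of_le_left (inv_pos.2 hc).le)
  · rintro ⟨hpos, hC⟩ a
    refine ⟨?_, ?_⟩
    · obtain ⟨C, hC0, hCa⟩ := hC a
      refine ⟨C⁻¹, inv_pos.2 hC0, .of_forall fun x => ?_⟩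
      rw [le_div_iff₀ (hpos x), inv_mul_eq_div, div_le_iff₀' hC0]
      exact hCa x
    · obtain ⟨C, -, hCa⟩ := hC (-a)
      refine ⟨C, .of_forall fun x => ?_⟩
      rw [div_le_iff₀ (hpos x)]
      simpa using hCa (x + a)

theorem measure_lt_add_eq_lintegral {Ω : Type*} [MeasurableSpace Ω] (P : Measure Ω)
    [IsProbabilityMeasure P] {X Y : Ω → ℝ} (hX : Measurable X) (hY : Measurable Y)
    (hXY : IndepFun X Y P) (x : ℝ) :
    P {ω | x < X ω + Y ω} = ∫⁻ y, P {ω | x - y < X ω} ∂(P.map Y) := by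
  have hs : MeasurableSet {p : ℝ × ℝ | x < p.1 + p.2} :=
    measurableSet_lt measurable_const (measurable_fst.add measurable_snd)
  have := Measure.isProbabilityMeasure_map (μ := P) hX.aemeasurable
  have := Measure.isProbabilityMeasure_map (μ := P) hY.aemeasurable
  calc P {ω | x < X ω + Y ω} = P.map (fun ω => (X ω, Y ω)) {p | x < p.1 + p.2} :=
        (Measure.map_apply (hX.prodMk hY) hs).symm
    _ = ∫⁻ y, P.map X ((fun u => (u, y)) ⁻¹' {p | x < p.1 + p.2}) ∂(P.map Y) := by
        rw [(indepFun_iff_map_prod_eq_prod_map_map hX.aemeasurable hY.aemeasurable).1 hXY,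
          Measure.prod_apply_symm hs]
    _ = _ := by
        refine lintegral_congr fun y => ?_
        rw [Measure.map_apply hX (measurable_prodMk_right hs)]
        simp [sub_lt_iff_lt_add]

/-- If `X₁`, `X₂` are independent and both `F_{X₁}` and `F_{X₂}` belong to `𝒪ℒ`,
then the distribution function `F_{X₁} ∗ F_{X₂}` of `X₁ + X₂` belongs to `𝒪ℒ`. -/
theorem ol_conv_of_ol {Ω : Type*} [MeasurableSpace Ω] (P : Measure Ω)
    [IsProbabilityMeasure P] (X₁ X₂ : Ω → ℝ) (h₁ : Measurable X₁) (h₂ : Measurable X₂)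
    (hind : IndepFun X₁ X₂ P) (hOL₁ : MemOL (df P X₁)) (hOL₂ : MemOL (df P X₂)) :
    MemOL (df P fun ω => X₁ ω + X₂ ω) := by
  rw [memOL_df_iff P h₁] at hOL₁
  rw [memOL_df_iff P h₂] at hOL₂
  obtain ⟨hpos₁, hC⟩ := hOL₁
  rw [memOL_df_iff P (X := fun ω => X₁ ω + X₂ ω) (h₁.add h₂)]
  refine ⟨fun x => ?_, fun a => ?_⟩
  · calc 0 < P.real {ω | x < X₁ ω} * P.real {ω | 0 < X₂ ω} := mul_pos (hpos₁ x) (hOL₂.1 0)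
      _ = P.real (X₁ ⁻¹' Set.Ioi x ∩ X₂ ⁻¹' Set.Ioi 0) := by
          rw [measureReal_def, measureReal_def, measureReal_def,
            hind.measure_inter_preimage_eq_mul _ _ measurableSet_Ioi measurableSet_Ioi,
            ENNReal.toReal_mul]
          rfl
      _ ≤ P.real {ω | x < X₁ ω + X₂ ω} := measureReal_mono fun ω hω => by
          simp only [Set.mem_inter_iff, Set.mem_preimage, Set.mem_Ioi] at hω
          simp only [Set.mem_ofPred_eq]
          linarith
  · obtain ⟨C, hC0, hCa⟩ := hC a
    refine ⟨C, hC0, fun x => ?_⟩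
    rw [measureReal_def, measureReal_def, ← ENNReal.toReal_ofReal hC0.le, ← ENNReal.toReal_mul]
    refine ENNReal.toReal_mono (by finiteness) ?_
    rw [measure_lt_add_eq_lintegral P h₁ h₂ hind, measure_lt_add_eq_lintegral P h₁ h₂ hind,
      ← lintegral_const_mul' _ _ ENNReal.ofReal_ne_top]
    refine lintegral_mono fun y => ?_
    rw [← ofReal_measureReal, ← ofReal_measureReal, ← ENNReal.ofReal_mul hC0.le,
      add_sub_right_comm]
    exact ENNReal.ofReal_le_ofReal (hCa (x - y))
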